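/- arXiv:1304.7198 — 2 statements merged into one kernel-verified Lean document; each statement's English description precedes it below -/
import Mathlib

section
/- Let K ≥ 1 and for each k = 1,…,K let I_k ≥ 2 be an integer and S_k > 0 a real number, and define χ_k : [0,1) → ℝ by χ_k(ρ) = ((1+(I_k−1)ρ)(1−ρ)^{I_k−1})^{−1/2} · exp(−I_k·S_k·ρ/(2(1−ρ))). Define ρ̂_k = (1/2)(1−S_k)(1 + √(1 − 4S_k/((I_k−1)(1−S_k)²))) if S_k < (√I_k−1)/(√I_k+1), and ρ̂_k = 0 otherwise. Then the supremum of the product ∏_{k=1}^K χ_k(ρ_k) over (ρ_1,…,ρ_K) ∈ (0,1)^K equals ∏_{k=1}^K max{χ_k(ρ̂_k), 1}. -/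
open Real Set

/-- The likelihood ratio factor `χ(ρ)` for a group of `I` cells with normalized
within-group sum of squares `S`. -/
noncomputable def chiFun (I : ℕ) (S ρ : ℝ) : ℝ :=
  ((1 + ((I : ℝ) - 1) * ρ) * (1 - ρ) ^ (I - 1)) ^ (-(1 : ℝ) / 2) *
    Real.exp (-((I : ℝ) * S * ρ) / (2 * (1 - ρ)))

/-- The candidate maximizer `ρ̂`, set to `0` when `S ≥ (√I−1)/(√I+1)`. -/
noncomputable def rhoHat (I : ℕ) (S : ℝ) : ℝ :=
  if S < (Real.sqrt I - 1) / (Real.sqrt I + 1) then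
    (1 / 2) * (1 - S) * (1 + Real.sqrt (1 - 4 * S / (((I : ℝ) - 1) * (1 - S) ^ 2)))
  else 0


noncomputable def gAux (I : ℕ) (S ρ : ℝ) : ℝ :=
  -(1/2) * Real.log (1 + ((I : ℝ) - 1) * ρ) - (((I : ℝ) - 1) / 2) * Real.log (1 - ρ)
    - ((I : ℝ) * S / 2) * ((1 - ρ)⁻¹ - 1)

lemma chi_eq (I : ℕ) (hI : 2 ≤ I) (S ρ : ℝ) (h0 : 0 ≤ ρ) (h1 : ρ < 1) :
    chiFun I S ρ = Real.exp (gAux I S ρ) := by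
  have hI' : (2 : ℝ) ≤ I := by exact_mod_cast hI
  have hp : 0 < 1 + ((I : ℝ) - 1) * ρ := by nlinarith
  have hq : 0 < 1 - ρ := by linarith
  unfold chiFun gAux
  rw [Real.rpow_def_of_pos (by positivity), ← Real.exp_add,
    Real.log_mul hp.ne' (by positivity), Real.log_pow, Nat.cast_sub (by omega)]
  congr 1
  push_cast
  field_simp
  ring

lemma g_deriv (I : ℕ) (hI : 2 ≤ I) (S ρ : ℝ) (h0 : 0 ≤ ρ) (h1 : ρ < 1) :
    HasDerivAt (gAux I S) (((I : ℝ) / 2 / ((1 - ρ) ^ 2 * (1 + ((I : ℝ) - 1) * ρ))) *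
      (((I : ℝ) - 1) * ρ * (1 - ρ) - S * (1 + ((I : ℝ) - 1) * ρ))) ρ := by
  have hI' : (2 : ℝ) ≤ I := by exact_mod_cast hI
  have hp : 0 < 1 + ((I : ℝ) - 1) * ρ := by nlinarith
  have hq : 0 < 1 - ρ := by linarith
  have d1 : HasDerivAt (fun x : ℝ => 1 + ((I : ℝ) - 1) * x) ((I : ℝ) - 1) ρ := by
    simpa using ((hasDerivAt_id ρ).const_mul ((I : ℝ) - 1)).const_add 1
  have d2 : HasDerivAt (fun x : ℝ => 1 - x) (-1) ρ := by
    simpa using (hasDerivAt_id ρ).const_sub 1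
  have := (((d1.log hp.ne').const_mul (-(1/2))).sub
    ((d2.log hq.ne').const_mul (((I : ℝ) - 1) / 2))).sub
    (((d2.fun_inv hq.ne').sub_const 1).const_mul ((I : ℝ) * S / 2))
  refine this.congr_deriv ?_
  field_simp
  ring

lemma chi_anti (I : ℕ) (hI : 2 ≤ I) (S a b : ℝ) (h0 : 0 ≤ a) (hab : a ≤ b) (h1 : b < 1)
    (h : ∀ x, a < x → x < b → ((I : ℝ) - 1) * x * (1 - x) - S * (1 + ((I : ℝ) - 1) * x) ≤ 0) :
    chiFun I S b ≤ chiFun I S a := by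
  have hI' : (2 : ℝ) ≤ I := by exact_mod_cast hI
  rw [chi_eq I hI S b (by linarith) h1, chi_eq I hI S a h0 (by linarith)]
  apply Real.exp_le_exp.2
  have : AntitoneOn (gAux I S) (Icc a b) := by
    apply antitoneOn_of_hasDerivWithinAt_nonpos (convex_Icc a b)
      (f' := fun ρ => (((I : ℝ) / 2 / ((1 - ρ) ^ 2 * (1 + ((I : ℝ) - 1) * ρ))) *
      (((I : ℝ) - 1) * ρ * (1 - ρ) - S * (1 + ((I : ℝ) - 1) * ρ))))
    · intro x hx
      exact (g_deriv I hI S x (by linarith [hx.1]) (by linarith [hx.2])).continuousAt.continuousWithinAt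
    · intro x hx
      rw [interior_Icc] at hx
      exact (g_deriv I hI S x (by linarith [hx.1]) (by linarith [hx.2])).hasDerivWithinAt
    · intro x hx
      rw [interior_Icc] at hx
      have hp : 0 < 1 + ((I : ℝ) - 1) * x := by nlinarith [hx.1]
      exact mul_nonpos_of_nonneg_of_nonpos (by positivity) (h x hx.1 hx.2)
  exact this ⟨le_rfl, hab⟩ ⟨hab, le_rfl⟩ hab

lemma chi_mono (I : ℕ) (hI : 2 ≤ I) (S a b : ℝ) (h0 : 0 ≤ a) (hab : a ≤ b) (h1 : b < 1)
    (h : ∀ x, a < x → x < b → 0 ≤ ((I : ℝ) - 1) * x * (1 - x) - S * (1 + ((I : ℝ) - 1) * x)) :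
    chiFun I S a ≤ chiFun I S b := by
  have hI' : (2 : ℝ) ≤ I := by exact_mod_cast hI
  rw [chi_eq I hI S b (by linarith) h1, chi_eq I hI S a h0 (by linarith)]
  apply Real.exp_le_exp.2
  have : MonotoneOn (gAux I S) (Icc a b) := by
    apply monotoneOn_of_hasDerivWithinAt_nonneg (convex_Icc a b)
      (f' := fun ρ => (((I : ℝ) / 2 / ((1 - ρ) ^ 2 * (1 + ((I : ℝ) - 1) * ρ))) *
      (((I : ℝ) - 1) * ρ * (1 - ρ) - S * (1 + ((I : ℝ) - 1) * ρ))))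
    · intro x hx
      exact (g_deriv I hI S x (by linarith [hx.1]) (by linarith [hx.2])).continuousAt.continuousWithinAt
    · intro x hx
      rw [interior_Icc] at hx
      exact (g_deriv I hI S x (by linarith [hx.1]) (by linarith [hx.2])).hasDerivWithinAt
    · intro x hx
      rw [interior_Icc] at hx
      have hp : 0 < 1 + ((I : ℝ) - 1) * x := by nlinarith [hx.1]
      exact mul_nonneg (by positivity) (h x hx.1 hx.2)
  exact this ⟨le_rfl, hab⟩ ⟨hab, le_rfl⟩ hab

lemma chi_zero (I : ℕ) (S : ℝ) : chiFun I S 0 = 1 := by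
  simp [chiFun]

lemma chi_bound (I : ℕ) (hI : 2 ≤ I) (S : ℝ) (hS : 0 < S) :
    (0 ≤ rhoHat I S ∧ rhoHat I S < 1) ∧
    ∀ x, 0 ≤ x → x < 1 → chiFun I S x ≤ max (chiFun I S (rhoHat I S)) 1 := by
  have hI' : (2 : ℝ) ≤ I := by exact_mod_cast hI
  obtain ⟨w, hw⟩ : ∃ w, w = Real.sqrt I := ⟨_, rfl⟩
  have hw2 : w ^ 2 = I := by rw [hw]; exact Real.sq_sqrt (by linarith)
  have hw0 : 0 ≤ w := by rw [hw]; positivity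
  have hw1 : 1 < w := by nlinarith
  unfold rhoHat
  rw [← hw]
  split_ifs with hc
  · rw [lt_div_iff₀ (by linarith)] at hc
    obtain ⟨m, hm⟩ : ∃ m : ℝ, m = (I : ℝ) - 1 := ⟨_, rfl⟩
    have hS1 : S < 1 := by nlinarith
    have hm1 : 1 ≤ m := by linarith
    have hmw : m = (w - 1) * (w + 1) := by rw [hm, ← hw2]; ring
    have key : 4 * S ≤ m * (1 - S) ^ 2 := by
      have h2 : 2 ≤ (1 - S) * (w + 1) := by nlinarith
      have h3 : 4 ≤ ((1 - S) * (w + 1)) ^ 2 := by nlinarith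
      have h4 : (w - 1) * 4 ≤ (w - 1) * ((1 - S) * (w + 1)) ^ 2 :=
        mul_le_mul_of_nonneg_left h3 (by linarith)
      have h5 : 4 * S * (w + 1) ≤ (m * (1 - S) ^ 2) * (w + 1) := by
        rw [hmw]; nlinarith
      exact le_of_mul_le_mul_right h5 (by linarith)
    rw [← hm]
    have hpos : 0 < m * (1 - S) ^ 2 := by
      have : 0 < 1 - S := by linarith
      positivity
    obtain ⟨t, ht⟩ : ∃ t, t = Real.sqrt (1 - 4 * S / (m * (1 - S) ^ 2)) := ⟨_, rfl⟩
    have ht2 : t ^ 2 = 1 - 4 * S / (m * (1 - S) ^ 2) := by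
      rw [ht]; apply Real.sq_sqrt
      rw [sub_nonneg, div_le_one hpos]; exact key
    have ht0 : 0 ≤ t := by rw [ht]; positivity
    have ht1 : t ≤ 1 := by
      have : 0 < 4 * S / (m * (1 - S) ^ 2) := by positivity
      nlinarith
    have htS : m * (1 - S) ^ 2 * (1 - t ^ 2) = 4 * S := by
      rw [ht2, sub_sub_cancel, mul_div_cancel₀ _ hpos.ne']
    rw [← ht]
    obtain ⟨r, hr⟩ : ∃ r, r = 1 / 2 * (1 - S) * (1 + t) := ⟨_, rfl⟩
    obtain ⟨s, hs⟩ : ∃ s, s = 1 / 2 * (1 - S) * (1 - t) := ⟨_, rfl⟩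
    rw [← hr]
    have hfac : ∀ x, m * x * (1 - x) - S * (1 + m * x) = m * ((x - s) * (r - x)) := by
      intro x
      rw [hr, hs]; linear_combination (1/4) * htS
    have hs0 : 0 ≤ s := by
      rw [hs]; exact mul_nonneg (by linarith) (by linarith)
    have hsr : s ≤ r := by rw [hr, hs]; nlinarith
    have hr1 : r < 1 := by rw [hr]; nlinarith
    refine ⟨⟨by linarith, hr1⟩, ?_⟩
    intro x hx0 hx1
    rcases le_total x s with h | h
    · apply le_max_of_le_right
      rw [← chi_zero I S]
      apply chi_anti I hI S 0 x le_rfl hx0 hx1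
      intro y hy1 hy2
      rw [← hm, hfac]
      exact mul_nonpos_of_nonneg_of_nonpos (by linarith)
        (mul_nonpos_of_nonpos_of_nonneg (by linarith) (by linarith))
    · apply le_max_of_le_left
      rcases le_total x r with h' | h'
      · apply chi_mono I hI S x r hx0 h' hr1
        intro y hy1 hy2
        rw [← hm, hfac]
        exact mul_nonneg (by linarith) (mul_nonneg (by linarith) (by linarith))
      · apply chi_anti I hI S r x (by linarith) h' hx1
        intro y hy1 hy2
        rw [← hm, hfac]
        exact mul_nonpos_of_nonneg_of_nonpos (by linarith)
          (mul_nonpos_of_nonneg_of_nonpos (by linarith) (by linarith))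
  · rw [not_lt, div_le_iff₀ (by linarith)] at hc
    refine ⟨⟨le_rfl, one_pos⟩, ?_⟩
    intro x hx0 hx1
    apply le_max_of_le_left
    apply chi_anti I hI S 0 x le_rfl hx0 hx1
    intro y hy1 hy2
    rw [← hw2]
    have hp : 0 ≤ 1 + (w ^ 2 - 1) * y := by nlinarith
    have h1 := mul_le_mul_of_nonneg_right hc hp
    have h2 : 0 ≤ (w - 1) * (1 - (w + 1) * y) ^ 2 := mul_nonneg (by linarith) (sq_nonneg _)
    have h3 : ((w ^ 2 - 1) * y * (1 - y) - S * (1 + (w ^ 2 - 1) * y)) * (w + 1) ≤ 0 * (w + 1) := by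
      nlinarith
    exact le_of_mul_le_mul_right h3 (by linarith)

theorem sup_prod_chi (K : ℕ) (hK : 1 ≤ K) (I : Fin K → ℕ) (hI : ∀ k, 2 ≤ I k)
    (S : Fin K → ℝ) (hS : ∀ k, 0 < S k) :
    sSup ((fun ρ : Fin K → ℝ => ∏ k, chiFun (I k) (S k) (ρ k)) ''
        {ρ | ∀ k, ρ k ∈ Ioo (0 : ℝ) 1}) =
      ∏ k, max (chiFun (I k) (S k) (rhoHat (I k) (S k))) 1 := by
  have hub : ∀ y ∈ ((fun ρ : Fin K → ℝ => ∏ k, chiFun (I k) (S k) (ρ k)) ''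
        {ρ | ∀ k, ρ k ∈ Ioo (0 : ℝ) 1}),
      y ≤ ∏ k, max (chiFun (I k) (S k) (rhoHat (I k) (S k))) 1 := by
    rintro y ⟨ρ, hρ, rfl⟩
    apply Finset.prod_le_prod
    · intro k _
      rw [chi_eq _ (hI k) _ _ (hρ k).1.le (hρ k).2]
      exact (Real.exp_pos _).le
    · intro k _
      exact (chi_bound _ (hI k) _ (hS k)).2 _ (hρ k).1.le (hρ k).2
  apply le_antisymm
  · apply csSup_le _ hub
    exact ⟨_, fun _ => 1/2, fun k => ⟨by norm_num, by norm_num⟩, rfl⟩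
  · have hex : ∀ k, ∃ r, 0 ≤ r ∧ r < 1 ∧
        max (chiFun (I k) (S k) (rhoHat (I k) (S k))) 1 = chiFun (I k) (S k) r := by
      intro k
      have hb := (chi_bound _ (hI k) _ (hS k)).1
      rcases max_choice (chiFun (I k) (S k) (rhoHat (I k) (S k))) 1 with h | h
      · exact ⟨_, hb.1, hb.2, h⟩
      · exact ⟨0, le_rfl, one_pos, h.trans (chi_zero _ _).symm⟩
    choose r hr0 hr1 hr using hex
    simp only [hr]
    have hlim : Filter.Tendsto (fun e : ℝ => ∏ k, Real.exp (gAux (I k) (S k) (r k + (1 - r k) * e)))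
        (nhdsWithin 0 (Ioo 0 1)) (nhds (∏ k, chiFun (I k) (S k) (r k))) := by
      apply tendsto_finsetProd
      intro k _
      rw [chi_eq _ (hI k) _ _ (hr0 k) (hr1 k)]
      apply (Real.continuous_exp.tendsto _).comp
      apply (g_deriv _ (hI k) (S k) _ (hr0 k) (hr1 k)).continuousAt.tendsto.comp
      apply Filter.Tendsto.mono_left _ nhdsWithin_le_nhds
      have : Continuous (fun e : ℝ => r k + (1 - r k) * e) := by fun_prop
      simpa using this.tendsto 0
    have : (nhdsWithin (0:ℝ) (Ioo 0 1)).NeBot := by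
      apply mem_closure_iff_nhdsWithin_neBot.1
      rw [closure_Ioo (by norm_num)]
      simp
    apply le_of_tendsto hlim
    filter_upwards [self_mem_nhdsWithin] with e he
    apply le_csSup ⟨_, hub⟩
    have hm : ∀ k, r k + (1 - r k) * e ∈ Ioo (0:ℝ) 1 := by
      intro k
      have := hr0 k
      have := hr1 k
      constructor <;> nlinarith [he.1, he.2]
    refine ⟨fun k => r k + (1 - r k) * e, hm, ?_⟩
    apply Finset.prod_congr rfl
    intro k _
    exact chi_eq _ (hI k) _ _ (hm k).1.le (hm k).2
end

section
/- Let d ≥ 2 be an integer and 0 ≤ ρ < 1, and let Z = (Z_1,…,Z_d) be a random vector with the centered multivariate normal distribution on ℝ^d whose covariance matrix has all diagonal entries equal to 1 and all off-diagonal entries equal to ρ. Define Z̄ = (1/d)Σ_{i=1}^d Z_i and S² = (1/(d−1))Σ_{i=1}^d (Z_i−Z̄)². Then: (a) Z̄ and S² are independent random variables; (b) Z̄ has the normal distribution with mean 0 and variance (1+(d−1)ρ)/d; (c) (d−1)S²/(1−ρ) has the chi-squared distribution with d−1 degrees of freedom, i.e. the Gamma distribution with shape (d−1)/2 and rate 1/2.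 -/
open MeasureTheory ProbabilityTheory Finset

lemma mgf_gamma (a : ℝ) (ha : 0 < a) (t : ℝ) (ht : t < 1/2) :
    mgf id (gammaMeasure a (1/2)) t = ((1/2) / (1/2 - t)) ^ a := by
  have hΓ := Real.Gamma_pos_of_pos ha
  have h1 : 0 < 1/2 - t := by linarith
  rw [mgf, gammaMeasure, integral_withDensity_eq_integral_toReal_smul]
  rotate_left
  · exact (measurable_gammaPDFReal a (1/2)).ennreal_ofReal
  · exact ae_of_all _ fun x => by simp [gammaPDF]
  have : ∀ x, (gammaPDF a (1/2) x).toReal • Real.exp (t * id x) =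
      (Set.Ici (0:ℝ)).indicator (fun x => ((1/2:ℝ)^a / Real.Gamma a) *
        (x ^ (a-1) * Real.exp (-((1/2 - t) * x)))) x := by
    intro x
    rw [gammaPDF, ENNReal.toReal_ofReal (gammaPDFReal_nonneg ha (by norm_num) x), gammaPDFReal]
    by_cases hx : 0 ≤ x
    · simp only [hx, if_true, Set.indicator, Set.mem_Ici, smul_eq_mul, id]
      rw [show -((1/2 - t) * x) = -(1/2 * x) + t * x by ring, Real.exp_add]; ring
    · simp [hx, Set.indicator]
  simp_rw [this]
  rw [integral_indicator measurableSet_Ici, integral_Ici_eq_integral_Ioi, integral_const_mul,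
    Real.integral_rpow_mul_exp_neg_mul_Ioi ha h1, Real.div_rpow (by norm_num) h1.le,
    Real.div_rpow (by norm_num) h1.le, Real.one_rpow]
  field_simp

lemma charFun_gamma (a : ℝ) (ha : 0 < a) (t : ℝ) :
    charFun (gammaMeasure a (1/2)) t = ((1/2) / (1/2 - t * Complex.I)) ^ (a : ℂ) := by
  have hm := mgf_gamma a ha
  have hint : Set.Iio (1/2 : ℝ) ⊆ interior (integrableExpSet id (gammaMeasure a (1/2))) := by
    refine interior_maximal ?_ isOpen_Iio
    intro s hs
    by_contra h
    have := mgf_undef (X := id) (μ := gammaMeasure a (1/2)) (t := s) h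
    rw [hm s hs] at this
    have h1 : 0 < 1/2 - s := by simp at hs; linarith
    have : 0 < ((1/2) / (1/2 - s)) ^ a := by positivity
    linarith
  have hf : AnalyticOnNhd ℂ (complexMGF id (gammaMeasure a (1/2))) {z | z.re < 1/2} :=
    analyticOnNhd_complexMGF.mono fun z hz => hint hz
  have hopen : IsOpen {z : ℂ | z.re < 1/2} := isOpen_lt Complex.continuous_re continuous_const
  have hre : ∀ z ∈ {z : ℂ | z.re < 1/2}, 0 < ((1/2:ℂ) - z).re := by
    intro z hz
    simp at hz ⊢; linarith
  have hg : AnalyticOnNhd ℂ (fun z : ℂ => ((1/2) / (1/2 - z)) ^ (a : ℂ)) {z | z.re < 1/2} := by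
    apply DifferentiableOn.analyticOnNhd _ hopen
    intro z hz
    have h := hre z hz
    have hne : (1/2 - z) ≠ 0 := fun h0 => by rw [h0] at h; simp at h
    apply DifferentiableAt.differentiableWithinAt
    apply DifferentiableAt.cpow_const
    · fun_prop (disch := assumption)
    · left
      rw [div_eq_mul_inv, show (1/2 : ℂ) = ((1/2 : ℝ) : ℂ) by norm_num, Complex.re_ofReal_mul,
        Complex.inv_re]
      norm_num at h hne ⊢
      exact div_pos (by linarith) (Complex.normSq_pos.2 hne)
  have hpre : IsPreconnected {z : ℂ | z.re < 1/2} := (convex_halfSpace_re_lt _).isPreconnected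
  have key := hf.eqOn_of_preconnected_of_frequently_eq hg hpre (z₀ := 0) (by simp) (by
    have hs : Filter.Tendsto (fun n : ℕ => ((-(1 / ((n:ℝ) + 1)) : ℝ) : ℂ)) Filter.atTop (nhdsWithin 0 {0}ᶜ) := by
      apply tendsto_nhdsWithin_iff.2 ⟨?_, ?_⟩
      · have := (tendsto_one_div_add_atTop_nhds_zero_nat (𝕜 := ℝ)).neg
        have h2 := (Complex.continuous_ofReal.tendsto _).comp this
        rw [neg_zero, Complex.ofReal_zero] at h2
        exact h2
      · refine Filter.Eventually.of_forall fun n => ?_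
        have : (n:ℝ) + 1 ≠ 0 := by positivity
        simp only [Set.mem_compl_iff, Set.mem_singleton_iff, Complex.ofReal_eq_zero]
        simpa using this
    refine hs.frequently (Filter.Frequently.of_forall fun n => ?_)
    have h0 : -(1 / ((n:ℝ) + 1)) < 0 := by simp; positivity
    set s := -(1 / ((n:ℝ) + 1))
    rw [complexMGF_ofReal, hm s (by linarith), Complex.ofReal_cpow]
    · push_cast; rfl
    · have : 0 < 1/2 - s := by linarith
      positivity)
  rw [← complexMGF_id_mul_I]
  exact key (by simp)

lemma charFun_sq (t : ℝ) :
    charFun ((gaussianReal 0 1).map (fun x => x^2)) t = ((1/2) / (1/2 - t * Complex.I)) ^ (1/2 : ℂ) := by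
  have hre : 0 < ((1/2:ℂ) - t * Complex.I).re := by simp
  have hne : ((1/2:ℂ) - t * Complex.I) ≠ 0 := fun h0 => by rw [h0] at hre; simp at hre
  rw [charFun_apply_real, integral_map (by fun_prop) (by fun_prop),
    integral_gaussianReal_eq_integral_smul (by simp)]
  have : ∀ x : ℝ, gaussianPDFReal 0 1 x • Complex.exp (t * ((x^2 : ℝ) : ℂ) * Complex.I) =
     (((√(2 * Real.pi))⁻¹ : ℝ) : ℂ) * Complex.exp (-(1/2 - t * Complex.I) * (x:ℂ)^2) := by
    intro x
    simp only [gaussianPDFReal, Complex.real_smul]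
    push_cast
    rw [mul_assoc, ← Complex.exp_add]
    congr 2
    · simp
    · ring
  simp_rw [this]
  rw [integral_const_mul, integral_gaussian_complex hre]
  have e : (Real.pi / (1/2 - t * Complex.I) : ℂ) = ((2 * Real.pi : ℝ) : ℂ) * ((1/2) / (1/2 - t * Complex.I)) := by
    push_cast; field_simp
  have hp : 0 < 2 * Real.pi := by positivity
  have hw : ((1/2) / (1/2 - t * Complex.I) : ℂ) ≠ 0 := div_ne_zero (by norm_num) hne
  have h2 : (((2 * Real.pi : ℝ) : ℂ) * ((1/2) / (1/2 - t * Complex.I))) ≠ 0 :=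
    mul_ne_zero (by exact_mod_cast hp.ne') hw
  rw [e, Complex.cpow_def_of_ne_zero h2, Complex.log_ofReal_mul hp hw, add_mul, Complex.exp_add,
    ← Complex.cpow_def_of_ne_zero hw, ← mul_assoc, Complex.ofReal_log hp.le,
    ← Complex.cpow_def_of_ne_zero (by exact_mod_cast hp.ne'),
    show (1/2 : ℂ) = ((1/2 : ℝ) : ℂ) by norm_num, ← Complex.ofReal_cpow hp.le, ← Real.sqrt_eq_rpow,
    ← Complex.ofReal_mul, inv_mul_cancel₀ (by positivity)]
  simp

section Main
variable {Ω : Type*} [MeasureSpace Ω] [IsProbabilityMeasure (ℙ : Measure Ω)]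

lemma quad_form (d : ℕ) (ρ : ℝ) (a : Fin d → ℝ) :
    (∑ i, ∑ j, a i * a j * (if i = j then (1 : ℝ) else ρ)) =
      (1 - ρ) * ∑ i, a i ^ 2 + ρ * (∑ i, a i) ^ 2 := by
  have : ∀ i j, a i * a j * (if i = j then (1 : ℝ) else ρ) =
      (if i = j then (1 - ρ) * (a i * a j) else 0) + ρ * (a i * a j) := by
    intro i j; split_ifs <;> ring
  simp_rw [this, Finset.sum_add_distrib]
  simp only [Finset.sum_ite_eq, Finset.mem_univ, if_true, ← Finset.mul_sum, ← Finset.sum_mul]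
  simp only [pow_two]

lemma exists_basis (d : ℕ) (k₀ : Fin d) :
    ∃ b : OrthonormalBasis (Fin d) ℝ (EuclideanSpace ℝ (Fin d)), ∀ i, b k₀ i = 1 / √d := by
  have hd : (0:ℝ) < d := by exact_mod_cast k₀.pos
  let v : Fin d → EuclideanSpace ℝ (Fin d) := fun _ => WithLp.toLp 2 fun _ => 1 / √d
  have hv : Orthonormal ℝ (({k₀} : Set (Fin d)).domRestrict v) := by
    constructor
    · intro i
      simp only [Set.domRestrict_apply, v, EuclideanSpace.norm_eq]
      simp [hd.le, hd.ne']
    · intro i j hij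
      exact absurd (Subsingleton.elim i j) hij
  obtain ⟨b, hb⟩ := hv.exists_orthonormalBasis_extension_of_card_eq (by simp)
  exact ⟨b, fun i => by rw [hb k₀ rfl]⟩

/-- chi-squared from iid normals -/
lemma chi_sq {ι : Type*} (s : Finset ι) (hs : 0 < s.card) (Y : ι → Ω → ℝ)
    (hm : ∀ i, Measurable (Y i)) (hY : iIndepFun Y ℙ)
    (hl : ∀ i ∈ s, Measure.map (Y i) ℙ = gaussianReal 0 1) :
    Measure.map (fun ω => ∑ i ∈ s, Y i ω ^ 2) ℙ = gammaMeasure ((s.card : ℝ) / 2) (1 / 2) := by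
  have ha : 0 < (s.card : ℝ) / 2 := by positivity
  have := isProbabilityMeasure_gammaMeasure ha (r := 1/2) (by norm_num)
  have hmm : Measurable (fun ω => ∑ i ∈ s, Y i ω ^ 2) := by fun_prop
  have := Measure.isProbabilityMeasure_map (μ := (ℙ : Measure Ω)) hmm.aemeasurable
  apply Measure.ext_of_charFun
  have hY2 : iIndepFun (fun i ω => Y i ω ^ 2) ℙ := hY.comp (fun _ x => x ^ 2) (by fun_prop)
  rw [iIndepFun.charFun_map_fun_finsetSum_eq_prod (X := fun i ω => Y i ω ^ 2)
    (fun i _ => ((hm i).pow_const 2).aemeasurable) (hY2.restrict s)]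
  ext t
  rw [Finset.prod_apply, charFun_gamma _ ha]
  have : ∀ i ∈ s, charFun (Measure.map (fun ω => Y i ω ^ 2) ℙ) t =
      ((1/2) / (1/2 - t * Complex.I)) ^ (1/2 : ℂ) := by
    intro i hi
    rw [← charFun_sq, ← hl i hi, Measure.map_map (by fun_prop) (hm i)]
    rfl
  rw [Finset.prod_congr rfl this, Finset.prod_const, ← Complex.cpow_nat_mul]
  congr 1
  push_cast; ring

lemma map_linComb {d : ℕ} {ρ : ℝ}
    {Z : Ω → Fin d → ℝ}
    (hZgauss : ∀ a : Fin d → ℝ,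
      Measure.map (fun ω => ∑ i, a i * Z ω i) ℙ =
        gaussianReal 0
          (∑ i, ∑ j, a i * a j * (if i = j then (1 : ℝ) else ρ)).toNNReal)
    (k₀ : Fin d) (b : OrthonormalBasis (Fin d) ℝ (EuclideanSpace ℝ (Fin d)))
    (hb : ∀ i, b k₀ i = 1 / √d) (t : Fin d → ℝ) :
    Measure.map (fun ω => ∑ k, t k * ∑ i, b k i * Z ω i) ℙ =
      gaussianReal 0 (∑ k, t k ^ 2 * ((1 - ρ) + if k = k₀ then ρ * d else 0)).toNNReal := by
  have hd : (0:ℝ) < d := by exact_mod_cast k₀.pos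
  have h := hZgauss (fun i => ∑ k, t k * b k i)
  rw [quad_form] at h
  convert h using 2
  · ext ω
    simp_rw [Finset.mul_sum, Finset.sum_mul]
    rw [Finset.sum_comm]
    simp only [mul_assoc]
  · let a : EuclideanSpace ℝ (Fin d) := ∑ k, t k • b k
    have ha : ∀ i, a i = ∑ k, t k * b k i := by intro i; simp [a]
    have hrep : ∀ k, inner ℝ (b k) a = t k := fun k => b.orthonormal.inner_right_fintype t k
    have h1 : ∑ i, (∑ k, t k * b k i) ^ 2 = ∑ k, t k ^ 2 := by
      have := b.sum_sq_norm_inner_right a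
      simp_rw [hrep, EuclideanSpace.norm_sq_eq, ha, Real.norm_eq_abs, sq_abs] at this
      exact this.symm
    have h2 : ∑ i, (∑ k, t k * b k i) = √d * t k₀ := by
      rw [← hrep k₀, PiLp.inner_apply]
      simp only [hb, ← ha]
      simp [Finset.mul_sum, ← mul_assoc]
      field_simp
    rw [h1, h2, mul_pow, Real.sq_sqrt hd.le]
    congr 1
    simp_rw [mul_add, Finset.sum_add_distrib, ← Finset.sum_mul]
    simp
    ring
end Main

/-- For an equicorrelated standard normal vector `Z = (Z_1,…,Z_d)` (unit variances, all
pairwise correlations `ρ`, characterized by every linear combination `∑ aᵢ Zᵢ` being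
centered normal with variance `aᵀMa` where `M` is the equicorrelation matrix), the sample
mean `Z̄` and sample variance `S²` are independent, `Z̄ ~ N(0, (1+(d−1)ρ)/d)`, and
`(d−1)S²/(1−ρ)` is chi-squared with `d−1` degrees of freedom, i.e. Gamma with shape
`(d−1)/2` and rate `1/2`. -/
theorem sample_mean_var_equicorrelated_normal
    {Ω : Type*} [MeasureSpace Ω] [IsProbabilityMeasure (ℙ : Measure Ω)]
    (d : ℕ) (hd : 2 ≤ d) (ρ : ℝ) (hρ0 : 0 ≤ ρ) (hρ1 : ρ < 1)
    (Z : Ω → Fin d → ℝ) (hZmeas : Measurable Z)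
    (hZgauss : ∀ a : Fin d → ℝ,
      Measure.map (fun ω => ∑ i, a i * Z ω i) ℙ =
        gaussianReal 0
          (∑ i, ∑ j, a i * a j * (if i = j then (1 : ℝ) else ρ)).toNNReal) :
    IndepFun (fun ω => (∑ i, Z ω i) / d)
        (fun ω => (1 / ((d : ℝ) - 1)) * ∑ i, (Z ω i - (∑ j, Z ω j) / d) ^ 2) ℙ ∧
      Measure.map (fun ω => (∑ i, Z ω i) / d) ℙ =
        gaussianReal 0 (((1 + ((d : ℝ) - 1) * ρ) / d).toNNReal) ∧
      Measure.map
          (fun ω =>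
            ((d : ℝ) - 1) * ((1 / ((d : ℝ) - 1)) * ∑ i, (Z ω i - (∑ j, Z ω j) / d) ^ 2) /
              (1 - ρ)) ℙ =
        gammaMeasure (((d : ℝ) - 1) / 2) (1 / 2) := by
  have hd0 : (0:ℝ) < d := by positivity
  have hd1 : (0:ℝ) < (d:ℝ) - 1 := by
    have : (2:ℝ) ≤ d := by exact_mod_cast hd
    linarith
  have hr : 0 < 1 - ρ := by linarith
  let k₀ : Fin d := ⟨0, by omega⟩
  obtain ⟨b, hb⟩ := exists_basis d k₀
  have hZi : ∀ i, Measurable fun ω => Z ω i := fun i => (measurable_pi_apply i).comp hZmeas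
  let Y : Fin d → Ω → ℝ := fun k ω => ∑ i, b k i * Z ω i
  have hYm : ∀ k, Measurable (Y k) := fun k => by
    simp only [Y]; exact Finset.measurable_sum _ fun i _ => (hZi i).const_mul _
  have hlin := map_linComb hZgauss k₀ b hb
  let v : Fin d → ℝ := fun k => (1 - ρ) + if k = k₀ then ρ * d else 0
  have hv : ∀ k, 0 ≤ v k := fun k => by
    simp only [v]; split_ifs <;> positivity
  have hYl : ∀ k, Measure.map (Y k) ℙ = gaussianReal 0 (v k).toNNReal := by
    intro k
    have := hlin (Pi.single k 1)
    convert this using 2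
    · ext ω; simp [Y, Pi.single_apply]
    · simp [v, Pi.single_apply]
  have hind : iIndepFun Y ℙ := by
    rw [iIndepFun_iff_charFun_pi (fun k => (hYm k).aemeasurable)]
    intro t
    have hsum : charFun (Measure.map (fun ω => ∑ k, t k * Y k ω) ℙ) 1 =
        charFun (Measure.map (fun ω => WithLp.toLp 2 (Y · ω)) ℙ) t := by
      rw [charFun_apply, charFun_apply, integral_map, integral_map]
      · simp [PiLp.inner_apply]
      · fun_prop
      · fun_prop
      · fun_prop
      · fun_prop
    rw [← hsum, hlin]
    simp_rw [hYl, charFun_gaussianReal]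
    rw [← Complex.exp_sum]
    congr 1
    have hs : 0 ≤ ∑ k, t k ^ 2 * v k := Finset.sum_nonneg fun k _ => mul_nonneg (sq_nonneg _) (hv k)
    rw [Real.coe_toNNReal _ hs]
    simp only [Real.coe_toNNReal _ (hv _)]
    push_cast
    simp [Finset.sum_div, v, mul_comm]
  have hY0 : ∀ ω, Y k₀ ω = (∑ i, Z ω i) / √d := by
    intro ω
    simp only [Y, hb, ← Finset.mul_sum]
    ring
  have hmean : ∀ ω, (∑ i, Z ω i) / d = Y k₀ ω / √d := by
    intro ω
    rw [hY0, div_div, Real.mul_self_sqrt hd0.le]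
  have hSS : ∀ ω, ∑ i, (Z ω i - (∑ j, Z ω j) / d) ^ 2 = ∑ k ∈ univ.erase k₀, Y k ω ^ 2 := by
    intro ω
    have h1 : ∑ k, Y k ω ^ 2 = ∑ i, Z ω i ^ 2 := by
      have := b.sum_sq_norm_inner_right (WithLp.toLp 2 (Z ω))
      simp_rw [EuclideanSpace.norm_sq_eq, Real.norm_eq_abs, sq_abs, PiLp.inner_apply] at this
      rw [← this]
      simp [Y, mul_comm]
    have h2 : ∑ k ∈ univ.erase k₀, Y k ω ^ 2 + Y k₀ ω ^ 2 = ∑ k, Y k ω ^ 2 :=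
      Finset.sum_erase_add _ _ (mem_univ _)
    rw [hY0, div_pow, Real.sq_sqrt hd0.le, h1] at h2
    simp_rw [sub_sq, Finset.sum_add_distrib, Finset.sum_sub_distrib, ← Finset.sum_mul,
      ← Finset.mul_sum]
    simp only [Finset.sum_const, card_univ, Fintype.card_fin, nsmul_eq_mul]
    rw [← h2]
    field_simp
    ring
  refine ⟨?_, ?_, ?_⟩
  · have h := hind.indepFun_finset {k₀} (univ.erase k₀) (by simp) hYm
    have h' := h.comp (φ := fun y : ({k₀} : Finset (Fin d)) → ℝ => y ⟨k₀, by simp⟩ / √d)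
      (ψ := fun y : ↥(Finset.erase univ k₀) → ℝ => (1 / ((d : ℝ) - 1)) * ∑ k, y k ^ 2) (by fun_prop) (by fun_prop)
    convert h' using 1
    · ext ω; simp [hmean]
    · ext ω
      simp only [hSS, Function.comp]
      rw [Finset.sum_coe_sort (univ.erase k₀) (fun k => Y k ω ^ 2)]
  · have h := hZgauss (fun _ => 1 / d)
    rw [quad_form] at h
    convert h using 2
    · ext ω; rw [← Finset.mul_sum]; ring
    · congr 1
      simp
      field_simp
      ring
  · have hc : ((univ.erase k₀).card : ℝ) = (d:ℝ) - 1 := by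
      rw [card_erase_of_mem (mem_univ _), card_univ, Fintype.card_fin, Nat.cast_sub (by omega)]
      simp
    have hsc : iIndepFun (fun k ω => (√(1-ρ))⁻¹ * Y k ω) ℙ :=
      hind.comp (fun _ x => (√(1-ρ))⁻¹ * x) (by fun_prop)
    have h := chi_sq (univ.erase k₀) (by rw [← Nat.cast_pos (α := ℝ), hc]; exact hd1) _
      (fun k => (hYm k).const_mul _) hsc (by
        intro k hk
        have hk : k ≠ k₀ := by simpa using hk
        have hmm := Measure.map_map (μ := (ℙ : Measure Ω)) (g := fun x => (√(1-ρ))⁻¹ * x)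
          (by fun_prop) (hYm k)
        refine hmm.symm.trans ?_
        rw [hYl, gaussianReal_map_const_mul]
        congr 1
        · simp
        · apply NNReal.eq
          simp [v, hk, hr.le, hr.ne'])
    rw [hc] at h
    rw [← h]
    congr 1
    ext ω
    rw [hSS]
    simp_rw [mul_pow, ← Finset.mul_sum, inv_pow, Real.sq_sqrt hr.le]
    field_simp
end
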